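/- Every triangle-free finite simple graph on at most 10 vertices is semi-transitive. Consequently, the Grötzsch graph, having 11 vertices, is a smallest (by number of vertices) triangle-free non-semi-transitive graph. -/

import Mathlib

/-- `D` is an orientation of the simple graph `G`: every edge gets exactly one direction. -/
def SimpleGraph.IsOrientation {V : Type*} (G : SimpleGraph V) (D : V → V → Prop) : Prop :=
  (∀ u v, G.Adj u v ↔ D u v ∨ D v u) ∧ ∀ u v, D u v → ¬ D v u

/-- A digraph (given as a relation) is acyclic: no directed cycle. -/
def DigraphAcyclic {V : Type*} (D : V → V → Prop) : Prop :=
  ∀ v, ¬ Relation.TransGen D v v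

/-- `D` is a semi-transitive orientation of `G`: it is an acyclic orientation such that for every
directed path `p 0 → p 1 → ⋯ → p k`, either `p 0` and `p k` are non-adjacent in `G`, or
`p i → p j` is an arc for all `i < j`. -/
def SimpleGraph.IsSemitransitiveOrientation {V : Type*} (G : SimpleGraph V)
    (D : V → V → Prop) : Prop :=
  G.IsOrientation D ∧ DigraphAcyclic D ∧
    ∀ (k : ℕ) (p : Fin (k + 1) → V),
      (∀ i : Fin k, D (p i.castSucc) (p i.succ)) →
      (¬ G.Adj (p 0) (p (Fin.last k)) ∨ ∀ i j : Fin (k + 1), i < j → D (p i) (p j))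

/-- A graph is semi-transitive if it admits a semi-transitive orientation. -/
def SimpleGraph.Semitransitive {V : Type*} (G : SimpleGraph V) : Prop :=
  ∃ D : V → V → Prop, G.IsSemitransitiveOrientation D

/-- The Grötzsch graph: vertices are `none` (the apex `c`), `some (false, i)` (the cycle vertices
`u i`) and `some (true, i)` (the vertices `w i`), with indices `i : ZMod 5`. Its edges are
`u i — u (i+1)`, `w i — u (i+1)`, `w i — u (i-1)` and `c — w i`. -/
def grotzschGraph : SimpleGraph (Option (Bool × ZMod 5)) :=
  SimpleGraph.fromRel (fun a b =>
    (∃ i : ZMod 5, a = some (false, i) ∧ b = some (false, i + 1)) ∨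
    (∃ i : ZMod 5, a = some (true, i) ∧ (b = some (false, i + 1) ∨ b = some (false, i - 1))) ∨
    (∃ i : ZMod 5, a = none ∧ b = some (true, i)))


namespace SimpleGraph

section ThreeColoring

variable {V : Type*} {G : SimpleGraph V}

lemma CliqueFree.not_adj_of_adj_of_adj (hG : G.CliqueFree 3) {a b c : V} (hab : G.Adj a b)
    (hbc : G.Adj b c) : ¬ G.Adj a c := by
  classical
  exact fun hac ↦ hG {a, b, c} (is3Clique_triple_iff.2 ⟨hab, hac, hbc⟩)

lemma CliqueFree.semitransitive_of_colorable (hG : G.CliqueFree 3) (hc : G.Colorable 3) :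
    G.Semitransitive := by
  obtain ⟨c⟩ := hc
  refine ⟨fun u v ↦ G.Adj u v ∧ c u < c v, ⟨fun u v ↦ ⟨fun h ↦ ?_, ?_⟩, ?_⟩, ?_, ?_⟩
  · exact (lt_or_gt_of_ne (c.valid h)).imp (⟨h, ·⟩) (⟨h.symm, ·⟩)
  · rintro (h | h)
    exacts [h.1, h.1.symm]
  · exact fun u v h h' ↦ lt_asymm h.2 h'.2
  · intro v hv
    have key : ∀ w, Relation.TransGen (fun u v ↦ G.Adj u v ∧ c u < c v) v w → c v < c w := by
      intro w hw
      induction hw with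
      | single h => exact h.2
      | tail _ h ih => exact ih.trans h.2
    exact lt_irrefl _ (key v hv)
  · intro k p hp
    match k, p, hp with
    | 0, p, hp => exact .inr fun i j hij ↦ by omega
    | 1, p, hp =>
      refine .inr fun i j hij ↦ ?_
      obtain ⟨rfl, rfl⟩ : i = 0 ∧ j = 1 := by fin_cases i <;> fin_cases j <;> simp_all
      exact hp 0
    | 2, p, hp => exact .inl (hG.not_adj_of_adj_of_adj (hp 0).1 (hp 1).1)
    | k + 3, p, hp =>
      have h₀ : c (p 0) < c (p 1) := (hp 0).2
      have h₁ : c (p 1) < c (p 2) := (hp 1).2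
      have h₂ : c (p 2) < c (p 3) := (hp 2).2
      omega

/-- A shortest closed walk of odd length visits each vertex at most once. -/
lemma exists_odd_walk_getVert_injOn (h : ¬ G.Colorable 2) :
    ∃ (u : V) (w : G.Walk u u), Odd w.length ∧ Set.InjOn w.getVert {i | i < w.length} := by
  classical
  have hex : ∃ n, Odd n ∧ ∃ (u : V) (w : G.Walk u u), w.length = n := by
    rw [two_colorable_iff_forall_loop_even] at h
    push Not at h
    obtain ⟨u, w, hw⟩ := h
    exact ⟨_, Nat.not_even_iff_odd.1 hw, u, w, rfl⟩
  obtain ⟨hodd, u, w, hw⟩ := Nat.find_spec hex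
  have hmin : ∀ (a b : V) (p : G.Walk a b), a = b → p.length < w.length → Even p.length := by
    rintro a b p rfl hp
    by_contra hne
    exact Nat.find_min hex (hw ▸ hp) ⟨Nat.not_even_iff_odd.1 hne, a, p, rfl⟩
  rw [← hw] at hodd
  have hne : ∀ i j, i < j → j < w.length → w.getVert i ≠ w.getVert j := by
    intro i j hij hj heq
    have hout := hmin _ _ ((w.drop j).append (w.take i)) heq.symm
    have hin := hmin _ _ ((w.drop i).take (j - i)) (by
      rw [Walk.drop_getVert, heq]; congr 1; omega)
    simp only [Walk.length_append, Walk.drop_length, Walk.take_length] at hout hin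
    rw [Nat.even_iff] at hout hin
    rw [Nat.odd_iff] at hodd
    omega
  refine ⟨u, w, hodd, fun i hi j hj hij ↦ ?_⟩
  rcases lt_trichotomy i j with hlt | rfl | hlt
  · exact absurd hij (hne i j hlt hj)
  · rfl
  · exact absurd hij.symm (hne j i hlt hi)

/-- `f` traverses a cycle of length five. -/
def IsPentagon (G : SimpleGraph V) (f : ZMod 5 → V) : Prop :=
  Function.Injective f ∧ ∀ i, G.Adj (f i) (f (i + 1))

lemma CliqueFree.colorable_two_or_exists_isPentagon [Fintype V] (hG : G.CliqueFree 3)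
    (hV : Fintype.card V ≤ 6) : G.Colorable 2 ∨ ∃ f, G.IsPentagon f := by
  by_cases h : G.Colorable 2
  · exact .inl h
  obtain ⟨u, w, hodd, hinj⟩ := exists_odd_walk_getVert_injOn h
  have hle : w.length ≤ 6 := by
    have := Fintype.card_le_of_injective (fun i : Fin w.length ↦ w.getVert i)
      fun i j hij ↦ Fin.ext (hinj i.2 j.2 hij)
    simpa using this.trans hV
  have hadj : ∀ i < w.length, G.Adj (w.getVert i) (w.getVert (i + 1)) :=
    fun i hi ↦ w.adj_getVert_succ hi
  have hend : w.getVert w.length = w.getVert 0 := by simp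
  generalize w.length = n at *
  have hn : n = 1 ∨ n = 3 ∨ n = 5 := by
    rw [Nat.odd_iff] at hodd
    omega
  rcases hn with rfl | rfl | rfl
  · exact absurd hend (hadj 0 (by simp)).ne'
  · exact absurd (hend ▸ hadj 2 (by simp)).symm
      (hG.not_adj_of_adj_of_adj (hadj 0 (by simp)) (hadj 1 (by simp)))
  · refine .inr ⟨fun i ↦ w.getVert i.val, fun i j hij ↦ ?_, fun i ↦ ?_⟩
    · exact ZMod.val_injective 5 (hinj (ZMod.val_lt i) (ZMod.val_lt j) hij)
    · fin_cases i
      exacts [hadj 0 (by simp), hadj 1 (by simp), hadj 2 (by simp), hadj 3 (by simp),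
        (hend ▸ hadj 4 (by simp) : G.Adj (w.getVert 4) (w.getVert 0))]

lemma CliqueFree.exists_coloring_or_exists_isPentagon (hG : G.CliqueFree 3) (S : Finset V)
    (hS : S.card ≤ 6) :
    (∃ c : V → Fin 3, (∀ a, c a ≠ 2) ∧ ∀ a ∈ S, ∀ b ∈ S, G.Adj a b → c a ≠ c b) ∨
      ∃ f, G.IsPentagon f ∧ ∀ i, f i ∈ S := by
  classical
  have hfree : (G.induce (S : Set V)).CliqueFree 3 := hG.comap (Embedding.induce _).isContained
  rcases hfree.colorable_two_or_exists_isPentagon (by simpa using hS) with ⟨⟨c⟩⟩ | ⟨f, hf, hadj⟩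
  · refine .inl ⟨fun a ↦ if h : a ∈ S then (c ⟨a, h⟩).castSucc else 0, fun a ↦ ?_, ?_⟩
    · dsimp only
      split_ifs with h
      · exact (Fin.castSucc_lt_last _).ne
      · decide
    · intro a ha b hb hab
      simpa [ha, hb] using c.valid (show (G.induce (S : Set V)).Adj ⟨a, ha⟩ ⟨b, hb⟩ from hab)
  · exact .inr ⟨fun i ↦ f i, ⟨Subtype.val_injective.comp hf, hadj⟩, fun i ↦ (f i).2⟩

lemma exists_forall_eq_add_one_or_eq_sub_one (P : ZMod 5 → Prop) (hP : ∀ i, P i → ¬ P (i + 1)) :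
    ∃ i, ∀ j, P j → j = i + 1 ∨ j = i - 1 := by
  classical
  have key : ∀ p : ZMod 5 → Bool, (∀ i, p i → ¬ p (i + 1)) →
      ∃ i, ∀ j, p j → j = i + 1 ∨ j = i - 1 := by decide
  simpa using key (fun i ↦ decide (P i)) (by simpa using hP)

/-- The colouring `2, 0, 1, 0, 1` of the 5-cycle. -/
def pentagonColor (i : ZMod 5) : Fin 3 :=
  if i = 0 then 2 else if i = 1 ∨ i = 3 then 0 else 1

lemma pentagonColor_ne_of_adj : ∀ i j : ZMod 5, j = i + 1 ∨ i = j + 1 →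
    pentagonColor i ≠ pentagonColor j := by decide

/-- A twin of a cycle vertex other than `0` can be given the colour of that vertex. -/
lemma pentagonColor_ne_of_twin : ∀ i : ZMod 5, i ≠ 0 → ∀ j, j = i + 1 ∨ j = i - 1 →
    pentagonColor i ≠ pentagonColor j := by decide

lemma pentagonColor_ne_two : ∀ i : ZMod 5, i ≠ 0 → pentagonColor i ≠ 2 := by decide

lemma IsPentagon.adj_iff {f : ZMod 5 → V} (hf : G.IsPentagon f) (hG : G.CliqueFree 3)
    (i j : ZMod 5) : G.Adj (f i) (f j) ↔ j = i + 1 ∨ i = j + 1 := by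
  refine ⟨fun h ↦ ?_, ?_⟩
  · have hcases : ∀ i j : ZMod 5, i = j ∨ j = i + 1 ∨ i = j + 1 ∨ j = i + 1 + 1 ∨ i = j + 1 + 1 := by
      decide
    rcases hcases i j with rfl | hj | hj | rfl | rfl
    · exact absurd h (G.irrefl)
    · exact .inl hj
    · exact .inr hj
    · exact absurd h (hG.not_adj_of_adj_of_adj (hf.2 _) (hf.2 _))
    · exact absurd h.symm (hG.not_adj_of_adj_of_adj (hf.2 _) (hf.2 _))
  · rintro (rfl | rfl)
    exacts [hf.2 _, (hf.2 _).symm]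

variable [Fintype V] [DecidableEq V] [DecidableRel G.Adj]

lemma CliqueFree.colorable_three_of_four_le_degree (hG : G.CliqueFree 3)
    (hV : Fintype.card V ≤ 10) (v : V) (hv : 4 ≤ G.degree v) : G.Colorable 3 := by
  set S := (insert v (G.neighborFinset v))ᶜ with hSdef
  have hmem : ∀ a, a ∈ S ↔ a ≠ v ∧ ¬ G.Adj v a := by simp [hSdef]
  have hcard : S.card + (G.degree v + 1) ≤ 10 := by
    rw [hSdef, Finset.card_compl, Finset.card_insert_of_notMem (by simp), card_neighborFinset_eq_degree]
    have : G.degree v < Fintype.card V := G.degree_lt_card_verts v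
    omega
  have hindep : ∀ a b, G.Adj v a → G.Adj v b → ¬ G.Adj a b :=
    fun a b ha hb hab ↦ hG.not_adj_of_adj_of_adj ha hab hb
  rcases hG.exists_coloring_or_exists_isPentagon S (by omega) with ⟨c, hc2, hc⟩ | ⟨f, hf, hfS⟩
  · refine ⟨Coloring.mk (fun a ↦ if G.Adj v a then 2 else if a = v then 0 else c a) ?_⟩
    intro a b hab
    have := hindep a b
    have := hc a
    have := hc2 a
    have := hc2 b
    have := hab.symm
    by_cases ha : G.Adj v a <;> by_cases hb : G.Adj v b <;> by_cases hav : a = v <;>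
      by_cases hbv : b = v <;> simp_all [eq_comm]
  · have himage : Finset.univ.image f = S := by
      apply Finset.eq_of_subset_of_card_le
      · simpa [Finset.subset_iff] using hfS
      · rw [Finset.card_image_of_injective _ hf.1, Finset.card_univ, ZMod.card]
        omega
    have hsurj : ∀ a ∈ S, ∃ k, f k = a := by simp [← himage]
    have htwin : ∀ a, ∃ i, G.Adj v a → ∀ j, G.Adj a (f j) → j = i + 1 ∨ j = i - 1 := by
      intro a
      obtain ⟨i, hi⟩ := exists_forall_eq_add_one_or_eq_sub_one (fun j ↦ G.Adj a (f j))
        fun j hj hj' ↦ hG.not_adj_of_adj_of_adj hj (hf.2 j) hj'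
      exact ⟨i, fun _ ↦ hi⟩
    choose t ht using htwin
    choose! g hg using hsurj
    obtain ⟨s, hs⟩ : ∃ s, ∀ a, G.Adj v a → t a ≠ s := by
      by_contra! hcon
      have hsub : Finset.univ ⊆ (G.neighborFinset v).image t := by
        intro s _
        obtain ⟨a, ha, has⟩ := hcon s
        exact Finset.mem_image.2 ⟨a, by simpa using ha, has⟩
      have h₁ := Finset.card_le_card hsub
      have h₂ : ((G.neighborFinset v).image t).card ≤ G.degree v := Finset.card_image_le
      have h₃ := Finset.card_image_of_injective Finset.univ hf.1
      rw [himage, Finset.card_univ, ZMod.card] at h₃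
      rw [Finset.card_univ, ZMod.card] at h₁
      omega
    have hcross : ∀ a b, G.Adj v a → b ≠ v → G.Adj a b →
        pentagonColor (t a - s) ≠ pentagonColor (g b - s) := by
      intro a b ha hb hab
      have hgb := hg b ((hmem b).2 ⟨hb, fun h ↦ hindep a b ha h hab⟩)
      refine pentagonColor_ne_of_twin _ (sub_ne_zero.2 (hs a ha)) _ ?_
      refine (ht a ha (g b) (hgb.symm ▸ hab)).imp (fun h ↦ ?_) fun h ↦ ?_ <;> rw [h] <;> ring
    refine ⟨Coloring.mk (fun a ↦ if a = v then 2 else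
      if G.Adj v a then pentagonColor (t a - s) else pentagonColor (g a - s)) ?_⟩
    have hv2 : ∀ a, G.Adj v a → pentagonColor (t a - s) ≠ 2 := fun a ha ↦
      pentagonColor_ne_two _ (sub_ne_zero.2 (hs a ha))
    intro a b hab
    by_cases hav : a = v
    · subst hav
      simp [hab, hab.ne', (hv2 b hab).symm]
    by_cases hbv : b = v
    · subst hbv
      simp [hab.symm, hab.ne, hv2 a hab.symm]
    by_cases ha : G.Adj v a <;> by_cases hb : G.Adj v b
    · exact absurd hab (hindep a b ha hb)
    · simp [*]
    · simpa [*] using (hcross b a hb hav hab.symm).symm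
    · simp only [hav, hbv, ha, hb, if_false]
      have hga := hg a ((hmem a).2 ⟨hav, ha⟩)
      have hgb := hg b ((hmem b).2 ⟨hbv, hb⟩)
      rw [← hga, ← hgb, hf.adj_iff hG] at hab
      refine pentagonColor_ne_of_adj _ _ (hab.imp (fun h ↦ ?_) fun h ↦ ?_) <;> rw [h] <;> ring

lemma CliqueFree.exists_isIndepSet_card_four (hG : G.CliqueFree 3) (hV : 10 ≤ Fintype.card V)
    (hdeg : ∀ v, G.degree v ≤ 3) : ∃ I : Finset V, G.IsIndepSet I ∧ 4 ≤ I.card := by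
  have : Nonempty V := Fintype.card_pos_iff.1 (by omega)
  obtain ⟨v⟩ := this
  set T := (insert v (G.neighborFinset v))ᶜ with hT
  have hmem : ∀ a, a ∈ T ↔ a ≠ v ∧ ¬ G.Adj v a := by simp [hT]
  have hcard : 6 ≤ T.card := by
    rw [hT, Finset.card_compl, Finset.card_insert_of_notMem (by simp), card_neighborFinset_eq_degree]
    have := hdeg v
    omega
  obtain ⟨u, hu⟩ : T.Nonempty := Finset.card_pos.1 (by omega)
  have huv := (hmem u).1 hu
  by_cases h : 3 ≤ (T ∩ G.neighborFinset u).card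
  · refine ⟨insert v (T ∩ G.neighborFinset u), ?_, ?_⟩
    · intro a ha b hb hab hadj
      simp only [Finset.coe_insert, Set.mem_insert_iff, Finset.mem_coe, Finset.mem_inter, hmem,
        mem_neighborFinset] at ha hb
      rcases ha with rfl | ⟨ha, ha'⟩ <;> rcases hb with rfl | ⟨hb, hb'⟩
      · exact hab rfl
      · exact hb.2 hadj
      · exact ha.2 hadj.symm
      · exact hG.not_adj_of_adj_of_adj ha' hadj hb'
    · rw [Finset.card_insert_of_notMem (by simp [hmem])]
      omega
  · have h₁ := Finset.card_inter_add_card_sdiff T (G.neighborFinset u)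
    have h₂ := Finset.pred_card_le_card_erase (s := T \ G.neighborFinset u) (a := u)
    have hmem' : ∀ a ∈ (T \ G.neighborFinset u).erase u,
        a ≠ u ∧ ¬ G.Adj u a ∧ a ≠ v ∧ ¬ G.Adj v a := by
      simp +contextual [hmem]
    have hpair : ∀ x ∈ (T \ G.neighborFinset u).erase u,
        ∀ y ∈ (T \ G.neighborFinset u).erase u, x ≠ y → ¬ G.Adj x y →
        ∃ I : Finset V, G.IsIndepSet I ∧ 4 ≤ I.card := by
      intro x hx y hy hxy hadj
      have hx := hmem' x hx
      have hy := hmem' y hy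
      refine ⟨{v, u, x, y}, ?_, ?_⟩
      · simp only [Finset.coe_insert, Finset.coe_singleton, IsIndepSet, Set.pairwise_insert,
          Set.pairwise_singleton, Set.mem_insert_iff, Set.mem_singleton_iff, forall_eq_or_imp,
          forall_eq, G.adj_comm x u, G.adj_comm y u, G.adj_comm x v, G.adj_comm y v,
          G.adj_comm u v, G.adj_comm y x]
        tauto
      · rw [Finset.card_insert_of_notMem, Finset.card_insert_of_notMem, Finset.card_pair hxy]
        · simp [hx.1.symm, hy.1.symm]
        · simp [huv.1.symm, hx.2.2.1.symm, hy.2.2.1.symm]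
    obtain ⟨x, hx, y, hy, z, hz, hxy, hxz, hyz⟩ :=
      Finset.two_lt_card.1 (show 2 < ((T \ G.neighborFinset u).erase u).card by omega)
    by_cases hxy' : G.Adj x y
    · by_cases hyz' : G.Adj y z
      · exact hpair x hx z hz hxz (hG.not_adj_of_adj_of_adj hxy' hyz')
      · exact hpair y hy z hz hyz hyz'
    · exact hpair x hx y hy hxy hxy'

lemma CliqueFree.colorable_three_of_degree_le_three (hG : G.CliqueFree 3)
    (hV : Fintype.card V = 10) (hdeg : ∀ v, G.degree v ≤ 3) : G.Colorable 3 := by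
  obtain ⟨I₀, hI₀, hcard₀⟩ := hG.exists_isIndepSet_card_four hV.ge hdeg
  obtain ⟨I, hle, hI, hmax⟩ :=
    Finite.exists_le_maximal (p := fun I : Finset V ↦ G.IsIndepSet I) hI₀
  have hcard : Iᶜ.card ≤ 6 := by
    have := Finset.card_le_card hle
    rw [Finset.card_compl]
    omega
  have hindep : ∀ a ∈ I, ∀ b ∈ I, ¬ G.Adj a b := fun a ha b hb hab ↦ hI ha hb hab.ne hab
  have hdom : ∀ a ∉ I, ∃ i ∈ I, G.Adj a i := by
    intro a ha
    by_contra! hcon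
    refine ha (hmax (y := insert a I) ?_ (Finset.subset_insert a I) (Finset.mem_insert_self a I))
    change G.IsIndepSet ↑(insert a I)
    rw [Finset.coe_insert, IsIndepSet, Set.pairwise_insert]
    exact ⟨hI, fun b hb _ ↦ ⟨hcon b hb, fun h ↦ hcon b hb h.symm⟩⟩
  rcases hG.exists_coloring_or_exists_isPentagon Iᶜ hcard with ⟨c, hc2, hc⟩ | ⟨f, hf, hfI⟩
  · refine ⟨Coloring.mk (fun a ↦ if a ∈ I then 2 else c a) ?_⟩
    intro a b hab
    by_cases ha : a ∈ I <;> by_cases hb : b ∈ I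
    · exact absurd hab (hindep a ha b hb)
    · simpa [ha, hb] using (hc2 b).symm
    · simpa [ha, hb] using hc2 a
    · simpa [ha, hb] using hc a (by simpa) b (by simpa) hab
  · simp only [Finset.mem_compl] at hfI
    have hnbr : ∀ k, ∃ i ∈ I, G.Adj (f k) i ∧ ∀ a, G.Adj (f k) a → a = f (k + 1) ∨ a = f (k - 1) ∨ a = i := by
      intro k
      obtain ⟨i, hi, hki⟩ := hdom (f k) (hfI k)
      refine ⟨i, hi, hki, fun a ha ↦ ?_⟩
      have hne : f (k + 1) ≠ f (k - 1) := hf.1.ne ((by decide : ∀ k : ZMod 5, k + 1 ≠ k - 1) k)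
      have hsub : {f (k + 1), f (k - 1), i} ⊆ G.neighborFinset (f k) := by
        simp only [Finset.insert_subset_iff, Finset.singleton_subset_iff, mem_neighborFinset]
        exact ⟨hf.2 k, (hf.adj_iff hG _ _).2 (.inr (by ring)), hki⟩
      have hne' : ∀ j, f j ≠ i := fun j h ↦ hfI j (h ▸ hi)
      have heq := Finset.eq_of_subset_of_card_le hsub (by
        rw [card_neighborFinset_eq_degree, Finset.card_insert_of_notMem (by simp [hne, hne']),
          Finset.card_pair (hne' _)]
        exact hdeg _)
      have : a ∈ G.neighborFinset (f k) := by simpa using ha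
      simpa [← heq] using this
    have hout : ∀ a, a ∉ I → (∀ k, f k ≠ a) → ∀ k, ¬ G.Adj (f k) a := by
      intro a ha hfa k hka
      obtain ⟨i, hi, -, h⟩ := hnbr k
      rcases h a hka with rfl | rfl | rfl
      exacts [hfa _ rfl, hfa _ rfl, ha hi]
    have honly : ∀ a b, a ∉ I → b ∉ I → (∀ k, f k ≠ a) → (∀ k, f k ≠ b) → a = b := by
      intro a b ha hb hfa hfb
      by_contra hab
      have hsub : insert a (insert b (Finset.univ.image f)) ⊆ Iᶜ := by
        simp [Finset.subset_iff, ha, hb, hfI]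
      have := Finset.card_le_card hsub
      rw [Finset.card_insert_of_notMem (by simp [hab, hfa]),
        Finset.card_insert_of_notMem (by simp [hfb]), Finset.card_image_of_injective _ hf.1,
        Finset.card_univ, ZMod.card] at this
      omega
    obtain ⟨i, hi, hadj0, hi0⟩ := hnbr 0
    obtain ⟨α, β, hα, hβ, hαβ, hαf⟩ : ∃ α β : Fin 3, α ≠ 2 ∧ β ≠ 2 ∧ α ≠ β ∧
        ∀ k, k ≠ 0 → G.Adj (f k) i → pentagonColor k ≠ α := by
      have hcons : ∀ k l, G.Adj (f k) i → G.Adj (f l) i → l ≠ k + 1 := by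
        rintro k _ hk hl rfl
        exact hG.not_adj_of_adj_of_adj (hf.2 k) hl hk
      have hne1 : ¬ G.Adj (f 1) i := fun h ↦ hcons 0 1 hadj0 h (by decide)
      have hne4 : ¬ G.Adj (f 4) i := fun h ↦ hcons 4 0 h hadj0 (by decide)
      have hcases : ∀ k : ZMod 5, k = 0 ∨ k = 1 ∨ k = 2 ∨ k = 3 ∨ k = 4 := by decide
      by_cases h2 : G.Adj (f 2) i
      · refine ⟨0, 1, by decide, by decide, by decide, fun k hk hki ↦ ?_⟩
        rcases hcases k with rfl | rfl | rfl | rfl | rfl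
        exacts [absurd rfl hk, absurd hki hne1, by decide,
          absurd (by decide) (hcons 2 3 h2 hki), absurd hki hne4]
      · refine ⟨1, 0, by decide, by decide, by decide, fun k hk hki ↦ ?_⟩
        rcases hcases k with rfl | rfl | rfl | rfl | rfl
        exacts [absurd rfl hk, absurd hki hne1, absurd hki h2, by decide, absurd hki hne4]
    have hf0 : ∀ a ∈ I, a ≠ i → ¬ G.Adj (f 0) a := by
      intro a ha hai h
      rcases hi0 a h with rfl | rfl | rfl
      exacts [hfI _ ha, hfI _ ha, hai rfl]
    obtain ⟨col, hcolI, hcoli, hcolf, hcolout⟩ : ∃ col : V → Fin 3,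
        (∀ a ∈ I, a ≠ i → col a = 2) ∧ col i = α ∧ (∀ k, col (f k) = pentagonColor k) ∧
        ∀ a, a ∉ I → (∀ k, f k ≠ a) → col a = β := by
      refine ⟨fun a ↦ if a ∈ I then (if a = i then α else 2) else
        if ∃ k, f k = a then pentagonColor (Function.invFun f a) else β, ?_, ?_, ?_, ?_⟩
      · simp +contextual
      · simp [hi]
      · simp [hfI, Function.leftInverse_invFun hf.1 _]
      · simp +contextual
    have hval : ∀ k, pentagonColor k = 2 → k = 0 := by decide
    have hclass : ∀ a, (a ∈ I ∧ a ≠ i) ∨ a = i ∨ (∃ k, f k = a) ∨ (a ∉ I ∧ ∀ k, f k ≠ a) := by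
      intro a
      rw [← not_exists]
      tauto
    refine ⟨Coloring.mk col ?_⟩
    intro a b hab
    rcases hclass a with ⟨ha, hai⟩ | rfl | ⟨k, rfl⟩ | ⟨ha, hfa⟩ <;>
      rcases hclass b with ⟨hb, hbi⟩ | rfl | ⟨l, rfl⟩ | ⟨hb, hfb⟩
    · exact absurd hab (hindep _ ha _ hb)
    · exact absurd hab (hindep _ ha _ hi)
    · rw [hcolI _ ha hai, hcolf]
      exact fun h ↦ hf0 a ha hai (hval l h.symm ▸ hab.symm)
    · rw [hcolI _ ha hai, hcolout _ hb hfb]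
      exact hβ.symm
    · exact absurd hab (hindep _ hi _ hb)
    · exact absurd hab G.irrefl
    · rw [hcoli, hcolf]
      by_cases hl : l = 0
      · subst hl
        exact hα
      · exact (hαf l hl hab.symm).symm
    · rw [hcoli, hcolout _ hb hfb]
      exact hαβ
    · rw [hcolf, hcolI _ hb hbi]
      exact fun h ↦ hf0 b hb hbi (hval k h ▸ hab)
    · rw [hcoli, hcolf]
      by_cases hk : k = 0
      · subst hk
        exact hα.symm
      · exact hαf k hk hab
    · rw [hcolf, hcolf]
      exact pentagonColor_ne_of_adj _ _ ((hf.adj_iff hG _ _).1 hab)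
    · exact absurd hab (hout b hb hfb k)
    · rw [hcolI _ hb hbi, hcolout _ ha hfa]
      exact hβ
    · rw [hcoli, hcolout _ ha hfa]
      exact hαβ.symm
    · exact absurd hab.symm (hout a ha hfa l)
    · exact absurd (honly a b ha hb hfa hfb) hab.ne

end ThreeColoring

lemma CliqueFree.colorable_three_of_card_le_ten {V : Type*} [Fintype V] {G : SimpleGraph V}
    (hG : G.CliqueFree 3) (hV : Fintype.card V ≤ 10) : G.Colorable 3 := by
  classical
  rcases isEmpty_or_nonempty V with _ | _
  · exact Colorable.of_isEmpty 3
  obtain ⟨e⟩ := Function.Embedding.nonempty_of_card_le (β := Fin 10) (by simpa using hV)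
  have hfree : (G.map e).CliqueFree 3 := cliqueFree_map_iff.2 hG
  refine Colorable.of_hom (Embedding.map e G).toHom ?_
  by_cases h : ∃ v, 4 ≤ (G.map e).degree v
  · obtain ⟨v, hv⟩ := h
    exact hfree.colorable_three_of_four_le_degree (by simp) v hv
  · push Not at h
    exact hfree.colorable_three_of_degree_le_three (by simp) fun v ↦ Nat.le_of_lt_succ (h v)

section Orientation

variable {V : Type*} {G : SimpleGraph V} {D : V → V → Prop}

open Classical in
/-- The sign of the arc between `u` and `v` in the orientation `D`, seen from `u`. -/
noncomputable def arcSign (D : V → V → Prop) (u v : V) : ℤ := if D u v then 1 else -1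

lemma arcSign_eq (D : V → V → Prop) (u v : V) : arcSign D u v = 1 ∨ arcSign D u v = -1 := by
  unfold arcSign
  split_ifs <;> simp

lemma IsOrientation.arcSign_symm (hD : G.IsOrientation D) {u v : V} (h : G.Adj u v) :
    arcSign D v u = -arcSign D u v := by
  have h₁ := (hD.1 u v).1 h
  have h₂ := hD.2 u v
  unfold arcSign
  split_ifs <;> tauto

/-- In a semi-transitive orientation, an induced 4-cycle carries no directed path of length 3. -/
lemma IsSemitransitiveOrientation.not_directed_path_of_adj (hD : G.IsSemitransitiveOrientation D)
    {a b c d : V} (hda : G.Adj d a) (hac : ¬ G.Adj a c) (hab : D a b) (hbc : D b c) : ¬ D c d := by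
  intro hcd
  have hpath : ∀ i : Fin 3, D (![a, b, c, d] i.castSucc) (![a, b, c, d] i.succ) := by
    intro i
    fin_cases i
    exacts [hab, hbc, hcd]
  rcases hD.2.2 3 ![a, b, c, d] hpath with h | h
  · exact h hda.symm
  · exact hac ((hD.1.1 a c).2 (.inl (h 0 2 (by decide))))

lemma IsSemitransitiveOrientation.arcSign_sum_four_cycle (hD : G.IsSemitransitiveOrientation D)
    {a b c d : V} (hab : G.Adj a b) (hbc : G.Adj b c) (hcd : G.Adj c d) (hda : G.Adj d a)
    (hac : ¬ G.Adj a c) (hbd : ¬ G.Adj b d) :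
    arcSign D a b + arcSign D b c + arcSign D c d + arcSign D d a = 0 := by
  have hca := fun h ↦ hac (G.adj_symm h)
  have hdb := fun h ↦ hbd (G.adj_symm h)
  have o₁ := (hD.1.1 a b).1 hab
  have o₂ := (hD.1.1 b c).1 hbc
  have o₃ := (hD.1.1 c d).1 hcd
  have o₄ := (hD.1.1 d a).1 hda
  have p₁ := hD.not_directed_path_of_adj (b := b) hda hac
  have p₂ := hD.not_directed_path_of_adj (b := c) hab hbd
  have p₃ := hD.not_directed_path_of_adj (b := d) hbc hca
  have p₄ := hD.not_directed_path_of_adj (b := a) hcd hdb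
  have q₁ := hD.not_directed_path_of_adj (b := c) hda.symm hdb
  have q₂ := hD.not_directed_path_of_adj (b := b) hcd.symm hca
  have q₃ := hD.not_directed_path_of_adj (b := a) hbc.symm hbd
  have q₄ := hD.not_directed_path_of_adj (b := d) hab.symm hac
  unfold arcSign
  split_ifs <;> grind

end Orientation

end SimpleGraph

open SimpleGraph

lemma grotzschGraph_not_adj_outer_inner_self (i : ZMod 5) :
    ¬ grotzschGraph.Adj (some (false, i)) (some (true, i)) := by
  revert i
  simp [grotzschGraph]
  decide

lemma grotzschGraph_adj_outer (i j : ZMod 5) :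
    grotzschGraph.Adj (some (false, i)) (some (false, j)) ↔ j = i + 1 ∨ i = j + 1 := by
  revert i j
  simp [grotzschGraph]
  decide

lemma grotzschGraph_adj_inner_outer (i j : ZMod 5) :
    grotzschGraph.Adj (some (true, i)) (some (false, j)) ↔ j = i + 1 ∨ j = i - 1 := by
  simp [grotzschGraph]

lemma grotzschGraph_not_adj_inner (i j : ZMod 5) :
    ¬ grotzschGraph.Adj (some (true, i)) (some (true, j)) := by
  simp [grotzschGraph]

lemma grotzschGraph_adj_apex_inner (i : ZMod 5) :
    grotzschGraph.Adj none (some (true, i)) := by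
  simp [grotzschGraph]

lemma grotzschGraph_not_adj_apex_outer (i : ZMod 5) :
    ¬ grotzschGraph.Adj none (some (false, i)) := by
  simp [grotzschGraph]

lemma grotzschGraph_cliqueFree : grotzschGraph.CliqueFree 3 := by
  intro s hs
  obtain ⟨a, b, c, hab, hac, hbc, -⟩ := is3Clique_iff.1 hs
  have hout : ∀ i j k : ZMod 5, (j = i + 1 ∨ i = j + 1) → (k = i + 1 ∨ i = k + 1) →
      ¬ (k = j + 1 ∨ j = k + 1) := by decide
  have hin : ∀ i j k : ZMod 5, (j = i + 1 ∨ j = i - 1) → (k = i + 1 ∨ k = i - 1) →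
      ¬ (k = j + 1 ∨ j = k + 1) := by decide
  rcases a with _ | ⟨_ | _, i⟩ <;> rcases b with _ | ⟨_ | _, j⟩ <;> rcases c with _ | ⟨_ | _, k⟩ <;>
    first
    | exact grotzschGraph.irrefl hab
    | exact grotzschGraph.irrefl hbc
    | exact grotzschGraph.irrefl hac
    | exact grotzschGraph_not_adj_inner _ _ hab
    | exact grotzschGraph_not_adj_inner _ _ hbc
    | exact grotzschGraph_not_adj_inner _ _ hac
    | exact grotzschGraph_not_adj_apex_outer _ hab
    | exact grotzschGraph_not_adj_apex_outer _ hac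
    | exact grotzschGraph_not_adj_apex_outer _ hbc
    | exact grotzschGraph_not_adj_apex_outer _ hab.symm
    | exact grotzschGraph_not_adj_apex_outer _ hac.symm
    | exact grotzschGraph_not_adj_apex_outer _ hbc.symm
    | simp only [grotzschGraph_adj_outer, grotzschGraph_adj_inner_outer,
        grotzschGraph.adj_comm (some (false, _)) (some (true, _))] at hab hac hbc
      first
      | exact hout _ _ _ hab hac hbc
      | exact hin _ _ _ hab hac hbc
      | exact hin _ _ _ hab hbc hac
      | exact hin _ _ _ hac hbc hab

lemma grotzschGraph_not_semitransitive : ¬ grotzschGraph.Semitransitive := by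
  rintro ⟨D, hD⟩
  set u : ZMod 5 → Option (Bool × ZMod 5) := fun i ↦ some (false, i)
  set w : ZMod 5 → Option (Bool × ZMod 5) := fun i ↦ some (true, i)
  have huu : ∀ i, grotzschGraph.Adj (u i) (u (i + 1)) := fun i ↦
    (grotzschGraph_adj_outer _ _).2 (.inl rfl)
  have hwu : ∀ i, grotzschGraph.Adj (w i) (u (i + 1)) := fun i ↦
    (grotzschGraph_adj_inner_outer _ _).2 (.inl rfl)
  have huw : ∀ i, grotzschGraph.Adj (u i) (w (i + 1)) := fun i ↦
    ((grotzschGraph_adj_inner_outer _ _).2 (.inr (by ring))).symm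
  have hcw : ∀ i, grotzschGraph.Adj none (w i) := grotzschGraph_adj_apex_inner
  have hnuu : ∀ i, ¬ grotzschGraph.Adj (u i) (u (i + 1 + 1)) := fun i ↦ by
    rw [grotzschGraph_adj_outer]
    revert i
    decide
  -- The 4-cycles `u i, u (i + 1), u (i + 2), w (i + 1)` and `none, w i, u (i + 1), w (i + 2)`.
  have hrim : ∀ i, arcSign D (u i) (u (i + 1)) + arcSign D (u (i + 1)) (u (i + 1 + 1)) =
      arcSign D (u i) (w (i + 1)) + arcSign D (w (i + 1)) (u (i + 1 + 1)) := by
    intro i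
    have := hD.arcSign_sum_four_cycle (huu i) (huu (i + 1)) (hwu (i + 1)).symm (huw i).symm
      (hnuu i) (grotzschGraph_not_adj_outer_inner_self _)
    rw [hD.1.arcSign_symm (hwu (i + 1)), hD.1.arcSign_symm (huw i)] at this
    linarith
  have hapex : ∀ i, arcSign D (w i) (u (i + 1)) + arcSign D (u (i + 1)) (w (i + 1 + 1)) =
      arcSign D none (w (i + 1 + 1)) - arcSign D none (w i) := by
    intro i
    have := hD.arcSign_sum_four_cycle (hcw i) (hwu i) (huw (i + 1)) (hcw (i + 1 + 1)).symm
      (grotzschGraph_not_adj_apex_outer _) (grotzschGraph_not_adj_inner _ _)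
    rw [hD.1.arcSign_symm (hcw (i + 1 + 1))] at this
    linarith
  have hsum : ∑ i, arcSign D (u i) (u (i + 1)) = 0 := by
    have shift : ∀ g : ZMod 5 → ℤ, ∑ i, g (i + 1) = ∑ i, g i := fun g ↦
      Equiv.sum_comp (Equiv.addRight (1 : ZMod 5)) g
    have h₁ := Finset.sum_congr rfl fun i (_ : i ∈ Finset.univ) ↦ hrim i
    have h₂ := Finset.sum_congr rfl fun i (_ : i ∈ Finset.univ) ↦ hapex i
    simp only [Finset.sum_add_distrib, Finset.sum_sub_distrib] at h₁ h₂
    rw [shift fun i ↦ arcSign D (u i) (u (i + 1)),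
      shift fun i ↦ arcSign D (w i) (u (i + 1))] at h₁
    rw [shift fun i ↦ arcSign D (u i) (w (i + 1)), shift fun i ↦ arcSign D none (w (i + 1)),
      shift fun i ↦ arcSign D none (w i)] at h₂
    linarith
  have hexpand : ∀ g : ZMod 5 → ℤ, ∑ i, g i = g 0 + g 1 + g 2 + g 3 + g 4 := Fin.sum_univ_five
  rw [hexpand] at hsum
  have hsign := fun i ↦ arcSign_eq D (u i) (u (i + 1))
  have h₀ := hsign 0
  have h₁ := hsign 1
  have h₂ := hsign 2
  have h₃ := hsign 3
  have h₄ := hsign 4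
  omega

/-- Every triangle-free graph on at most 10 vertices is semi-transitive; consequently the
Grötzsch graph, a triangle-free non-semi-transitive graph on 11 vertices, is a smallest
(by number of vertices) triangle-free non-semi-transitive graph. -/
theorem grotzsch_smallest_triangle_free_non_semitransitive :
    (∀ (V : Type) [Fintype V] (G : SimpleGraph V),
        Fintype.card V ≤ 10 → G.CliqueFree 3 → G.Semitransitive) ∧
    Fintype.card (Option (Bool × ZMod 5)) = 11 ∧
    grotzschGraph.CliqueFree 3 ∧
    ¬ grotzschGraph.Semitransitive := by
  refine ⟨fun V _ G hV hG ↦ ?_, by simp [ZMod.card], grotzschGraph_cliqueFree,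
    grotzschGraph_not_semitransitive⟩
  exact hG.semitransitive_of_colorable (hG.colorable_three_of_card_le_ten hV)
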